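/- Suppose that for some 1 ≤ p, q, r ≤ ∞ with 1/p + 1/q = 1/r and 2 ≤ p, q, r' the symbol e^{−i|ξ−η|²} belongs to ℳ_{p,q,r}(ℝⁿ), i.e. the associated bilinear operator T is bounded L^p × L^q → L^r with norm M. Then for all t ≠ 0 and all Schwartz functions f, g, h: |∫ f g h dx| ≤ C(p,q,r) · M · |t|^{−n/2} ‖f‖₂ ‖g‖₂ ‖h‖₂, where C(p,q,r) depends only on the exponents and the dimension. Since the left side is independent of t and can be nonzero, this yields a contradiction; hence e^{−i|ξ−η|²} ∉ ℳ_{p,q,r}(ℝⁿ) for any triplet in the local L² range. -/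

import Mathlib

open MeasureTheory FourierTransform RealInnerProductSpace Real ENNReal

/-- Each real iterated derivative of the complex exponential is controlled by the exponential. -/
lemma norm_iteratedFDeriv_cexp (n : ℕ) (z : ℂ) :
    ‖iteratedFDeriv ℝ n Complex.exp z‖ =
      ‖Complex.exp z‖ * ‖iteratedFDeriv ℝ n Complex.exp 0‖ := by
  have hsmooth : ContDiff ℝ n Complex.exp := Complex.contDiff_exp
  have htranslate : (fun w : ℂ => Complex.exp (z + w)) =
      fun w => Complex.exp z • Complex.exp w := by
    funext w
    rw [Complex.exp_add, smul_eq_mul]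
  have h := iteratedFDeriv_comp_add_left (𝕜 := ℝ) (f := Complex.exp) n z 0
  rw [htranslate, iteratedFDeriv_const_smul_apply' hsmooth.contDiffAt, add_zero] at h
  rw [← h, norm_smul]

lemma one_add_pow_mul_exp_neg_mul_sq_le {β : ℝ} (hβ : 0 < β) (m : ℕ) {t : ℝ} (ht : 0 ≤ t) :
    (1 + t) ^ m * rexp (-β * t ^ 2) ≤ m.factorial * rexp (1 + 1 / (4 * β)) := by
  have hpow := Real.pow_div_factorial_le_exp (x := 1 + t) (by positivity) m
  rw [div_le_iff₀ (by positivity)] at hpow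
  have hquad : 1 + t + -β * t ^ 2 ≤ 1 + 1 / (4 * β) := by
    have hsq : 1 / (4 * β) - t + β * t ^ 2 = β * (t - 1 / (2 * β)) ^ 2 := by
      field_simp
      ring
    nlinarith [mul_nonneg hβ.le (sq_nonneg (t - 1 / (2 * β)))]
  calc (1 + t) ^ m * rexp (-β * t ^ 2)
      ≤ rexp (1 + t) * m.factorial * rexp (-β * t ^ 2) := by gcongr
    _ = m.factorial * rexp (1 + t + -β * t ^ 2) := by rw [Real.exp_add (1 + t)]; ring
    _ ≤ _ := by gcongr

lemma norm_cexp_neg_mul_sq_norm {V : Type*} [NormedAddCommGroup V] (b : ℂ) (x : V) :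
    ‖Complex.exp (-b * ‖x‖ ^ 2)‖ = rexp (-b.re * ‖x‖ ^ 2) := by
  rw [Complex.norm_exp, ← Complex.ofReal_pow, Complex.re_mul_ofReal, Complex.neg_re]

lemma eLpNorm_cexp_neg_mul_sq_norm {V : Type*} [NormedAddCommGroup V] [MeasurableSpace V]
    (b : ℂ) (p : ℝ≥0∞) (μ : Measure V) :
    eLpNorm (fun x : V => Complex.exp (-b * ‖x‖ ^ 2)) p μ =
      eLpNorm (fun x : V => rexp (-b.re * ‖x‖ ^ 2)) p μ :=
  eLpNorm_congr_norm_ae (.of_forall fun x => by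
    rw [norm_cexp_neg_mul_sq_norm, Real.norm_of_nonneg (Real.exp_pos _).le])

section Gaussian

variable {V : Type*} [NormedAddCommGroup V] [InnerProductSpace ℝ V]

lemma hasTemperateGrowth_neg_mul_sq_norm (b : ℂ) :
    (fun x : V => -b * (‖x‖ : ℂ) ^ 2).HasTemperateGrowth := by
  have h := (Complex.ofRealCLM.hasTemperateGrowth).comp (Function.hasTemperateGrowth_norm_sq V)
  have heq : (fun x : V => -b * (‖x‖ : ℂ) ^ 2) =
      (fun _ => -b) * (Complex.ofRealCLM ∘ fun x : V => ‖x‖ ^ 2) := by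
    funext x
    simp
  exact heq ▸ (Function.HasTemperateGrowth.const (E := V) (-b)).mul h

lemma gaussian_decay {b : ℂ} (hb : 0 < b.re) (k n : ℕ) :
    ∃ C : ℝ, ∀ x : V,
      ‖x‖ ^ k * ‖iteratedFDeriv ℝ n (fun v : V => Complex.exp (-b * ‖v‖ ^ 2)) x‖ ≤ C := by
  have hphase := hasTemperateGrowth_neg_mul_sq_norm (V := V) b
  obtain ⟨l, A, hA, hphase_bound⟩ := hphase.norm_iteratedFDeriv_le_uniform n
  set E : ℝ := ∑ i ∈ Finset.range (n + 1), ‖iteratedFDeriv ℝ i Complex.exp 0‖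
  have hE0 : 0 ≤ E := Finset.sum_nonneg fun _ _ => norm_nonneg _
  refine ⟨n.factorial * E * (1 + A) ^ n *
    ((k + l * n).factorial * rexp (1 + 1 / (4 * b.re))), fun x => ?_⟩
  have hchain := norm_iteratedFDeriv_comp_le (𝕜 := ℝ) (n := n) (N := n) (g := Complex.exp)
    (f := fun v : V => -b * (‖v‖ : ℂ) ^ 2) Complex.contDiff_exp
    (hphase.1.of_le (mod_cast le_top)) le_rfl x
    (C := rexp (-b.re * ‖x‖ ^ 2) * E) (D := (1 + A) * (1 + ‖x‖) ^ l)
    (fun i hi => by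
      rw [norm_iteratedFDeriv_cexp, norm_cexp_neg_mul_sq_norm]
      gcongr
      exact Finset.single_le_sum (f := fun i => ‖iteratedFDeriv ℝ i Complex.exp 0‖)
        (fun _ _ => norm_nonneg _) (Finset.mem_range.2 (by omega)))
    (fun i hi hin => by
      have hone : 1 ≤ (1 + A) * (1 + ‖x‖) ^ l :=
        one_le_mul_of_one_le_of_one_le (by linarith)
          (one_le_pow₀ (by linarith [norm_nonneg x]))
      calc _ ≤ A * (1 + ‖x‖) ^ l := hphase_bound i hin x
        _ ≤ (1 + A) * (1 + ‖x‖) ^ l := by gcongr; linarith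
        _ ≤ _ := le_self_pow₀ hone (by omega))
  have hx : ‖x‖ ^ k ≤ (1 + ‖x‖) ^ k := by gcongr; linarith
  calc _ ≤ (1 + ‖x‖) ^ k * (n.factorial * (rexp (-b.re * ‖x‖ ^ 2) * E) *
          ((1 + A) * (1 + ‖x‖) ^ l) ^ n) := by
        gcongr
        exact hchain
    _ = n.factorial * E * (1 + A) ^ n *
          ((1 + ‖x‖) ^ (k + l * n) * rexp (-b.re * ‖x‖ ^ 2)) := by
        rw [mul_pow, ← pow_mul, pow_add]
        ring
    _ ≤ _ := mul_le_mul_of_nonneg_left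
        (one_add_pow_mul_exp_neg_mul_sq_le hb _ (norm_nonneg x)) (by positivity)

/-- The Gaussian `x ↦ exp (-b ‖x‖ ^ 2)` as a Schwartz function. -/
noncomputable def gaussianSchwartz (V : Type*) [NormedAddCommGroup V] [InnerProductSpace ℝ V]
    (b : ℂ) (hb : 0 < b.re) : SchwartzMap V ℂ where
  toFun := fun x => Complex.exp (-b * ‖x‖ ^ 2)
  smooth' := Complex.contDiff_exp.comp (hasTemperateGrowth_neg_mul_sq_norm b).1
  decay' := gaussian_decay hb

lemma coe_gaussianSchwartz {b : ℂ} (hb : 0 < b.re) :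
    ⇑(gaussianSchwartz V b hb) = fun x => Complex.exp (-b * ‖x‖ ^ 2) := rfl

variable [FiniteDimensional ℝ V] [MeasurableSpace V] [BorelSpace V]

lemma eLpNorm_rexp_neg_mul_sq_norm_ne_top {β : ℝ} (hβ : 0 < β) (p : ℝ≥0∞) :
    eLpNorm (fun x : V => rexp (-β * ‖x‖ ^ 2)) p volume ≠ ∞ := by
  have h := (gaussianSchwartz V (β : ℂ) (by simpa using hβ)).eLpNorm_lt_top p volume
  rw [coe_gaussianSchwartz, eLpNorm_cexp_neg_mul_sq_norm, Complex.ofReal_re] at h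
  exact h.ne

lemma eLpNorm_rexp_neg_mul_sq_norm_ne_zero (β : ℝ) {p : ℝ≥0∞} (hp : p ≠ 0) :
    eLpNorm (fun x : V => rexp (-β * ‖x‖ ^ 2)) p volume ≠ 0 := by
  have hcont : Continuous fun x : V => rexp (-β * ‖x‖ ^ 2) := by fun_prop
  rw [Ne, eLpNorm_eq_zero_iff hcont.aestronglyMeasurable hp]
  intro h
  obtain ⟨x, hx⟩ := h.exists
  exact (Real.exp_pos _).ne' hx

/-- Dilating a Gaussian by `√s` scales its `L^p` norm by a power `1 / p` of the Jacobian. -/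
lemma eLpNorm_rexp_neg_mul_sq_norm_scale (β : ℝ) {s : ℝ} (hs : 0 < s) (p : ℝ≥0∞) :
    eLpNorm (fun x : V => rexp (-(β * s) * ‖x‖ ^ 2)) p volume =
      ENNReal.ofReal |((√s) ^ Module.finrank ℝ V)⁻¹| ^ (1 / p).toReal *
        eLpNorm (fun x : V => rexp (-β * ‖x‖ ^ 2)) p volume := by
  have hsqrt : 0 < √s := Real.sqrt_pos.2 hs
  have hcont : Continuous fun x : V => rexp (-β * ‖x‖ ^ 2) := by fun_prop
  have hdilate : (fun x : V => rexp (-(β * s) * ‖x‖ ^ 2)) =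
      (fun x : V => rexp (-β * ‖x‖ ^ 2)) ∘ (fun x => √s • x) := by
    funext x
    rw [Function.comp_apply, norm_smul, mul_pow, Real.norm_of_nonneg hsqrt.le,
      Real.sq_sqrt hs.le]
    ring_nf
  have hjac : ENNReal.ofReal |((√s) ^ Module.finrank ℝ V)⁻¹| ≠ 0 := by
    rw [Ne, ENNReal.ofReal_eq_zero, not_le]
    positivity
  rw [hdilate, ← eLpNorm_map_measure hcont.aestronglyMeasurable (by fun_prop),
    Measure.map_addHaar_smul volume hsqrt.ne', eLpNorm_smul_measure_of_ne_zero hjac, smul_eq_mul]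

end Gaussian

section Symbol

variable {V : Type*} [NormedAddCommGroup V] [InnerProductSpace ℝ V] [FiniteDimensional ℝ V]
  [MeasurableSpace V] [BorelSpace V]

lemma integral_gaussian_mul_symbol {a : ℝ} (ha : 0 < a) (x : V) :
    ∫ ξ : V, ∫ η : V,
      Complex.exp (-(a - 2 * Complex.I) * ‖ξ‖ ^ 2) *
        Complex.exp (-(a - 2 * Complex.I) * ‖η‖ ^ 2) *
        Complex.exp (-Complex.I * ((‖ξ - η‖ : ℝ) ^ 2)) *
        Complex.exp (2 * (π : ℂ) * Complex.I * (⟪x, ξ + η⟫ : ℝ)) =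
      (π / (a - Complex.I)) ^ (Module.finrank ℝ V / 2 : ℂ) *
        (π / (a * (a - 2 * Complex.I) / (a - Complex.I))) ^ (Module.finrank ℝ V / 2 : ℂ) *
        Complex.exp (-(2 * π ^ 2 / (a - 2 * Complex.I)) * ‖x‖ ^ 2) := by
  set w : ℂ := a - Complex.I with hw
  set z : ℂ := a - 2 * Complex.I with hz
  have hwre : 0 < w.re := by simpa [hw] using ha
  have hzre : 0 < z.re := by simpa [hz] using ha
  have hw0 : w ≠ 0 := fun h => by simp [h] at hwre
  have hz0 : z ≠ 0 := fun h => by simp [h] at hzre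
  have ha0 : (a : ℂ) ≠ 0 := by exact_mod_cast ha.ne'
  have hB : a * z / w = w + 1 / w := by
    field_simp
    rw [hw, hz]
    linear_combination -Complex.I_sq
  have hBre : 0 < (a * z / w).re := by
    rw [hB, Complex.add_re, one_div, Complex.inv_re]
    have := Complex.normSq_pos.2 hw0
    positivity
  have hinner (ξ : V) : ∫ η : V,
      Complex.exp (-z * ‖ξ‖ ^ 2) * Complex.exp (-z * ‖η‖ ^ 2) *
        Complex.exp (-Complex.I * ((‖ξ - η‖ : ℝ) ^ 2)) *
        Complex.exp (2 * (π : ℂ) * Complex.I * (⟪x, ξ + η⟫ : ℝ)) =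
      (π / w) ^ (Module.finrank ℝ V / 2 : ℂ) * Complex.exp (-(π ^ 2 / w) * ‖x‖ ^ 2) *
        Complex.exp (-(a * z / w) * ‖ξ‖ ^ 2 + (2 * π * Complex.I * a / w) * (⟪x, ξ⟫ : ℝ)) := by
    have hsplit (η : V) : Complex.exp (-z * ‖ξ‖ ^ 2) * Complex.exp (-z * ‖η‖ ^ 2) *
        Complex.exp (-Complex.I * ((‖ξ - η‖ : ℝ) ^ 2)) *
        Complex.exp (2 * (π : ℂ) * Complex.I * (⟪x, ξ + η⟫ : ℝ)) =
        Complex.exp (-w * ‖ξ‖ ^ 2 + 2 * π * Complex.I * (⟪x, ξ⟫ : ℝ)) *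
          Complex.exp (-w * ‖η‖ ^ 2 +
            Complex.I * (⟪(2 : ℝ) • ξ + (2 * π) • x, η⟫ : ℝ)) := by
      simp only [← Complex.exp_add]
      rw [← Complex.ofReal_pow ‖ξ - η‖, norm_sub_sq_real, inner_add_right, inner_add_left,
        real_inner_smul_left, real_inner_smul_left]
      congr 1
      push_cast
      rw [hw, hz]
      ring
    simp only [hsplit]
    rw [integral_const_mul, GaussianFourier.integral_cexp_neg_mul_sq_norm_add hwre,
      mul_left_comm, ← Complex.exp_add,
      mul_assoc ((π / w : ℂ) ^ (Module.finrank ℝ V / 2 : ℂ)), ← Complex.exp_add,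
      ← Complex.ofReal_pow ‖(2 : ℝ) • ξ + (2 * π) • x‖, norm_add_sq_real, norm_smul, norm_smul,
      real_inner_smul_left, real_inner_smul_right, real_inner_comm x ξ,
      Real.norm_of_nonneg (by positivity : (0 : ℝ) ≤ 2),
      Real.norm_of_nonneg (by positivity : (0 : ℝ) ≤ 2 * π)]
    congr 2
    rw [hB]
    have hI : Complex.I * a / w = Complex.I - 1 / w := by
      field_simp
      rw [hw]
      linear_combination Complex.I_sq
    rw [show 2 * π * Complex.I * a / w = 2 * π * (Complex.I * a / w) by ring, hI, Complex.I_sq]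
    push_cast
    field_simp
    ring
  simp only [hinner]
  rw [integral_const_mul, GaussianFourier.integral_cexp_neg_mul_sq_norm_add hBre]
  rw [mul_mul_mul_comm, ← Complex.exp_add]
  congr 2
  rw [show (2 * π * Complex.I * a / w) ^ 2 = -(4 * π ^ 2 * a ^ 2 / w ^ 2) by
    rw [div_pow, mul_pow, mul_pow, Complex.I_sq]
    ring]
  field_simp
  rw [hw, hz]
  ring

/-- The squared modulus of the Fourier constant of the test Gaussian times the modulus of the
constants produced by the symbol. -/
lemma norm_gaussian_constants {a : ℝ} (ha : 0 < a) (n : ℕ) :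
    ‖(((a - 2 * Complex.I) / π : ℂ) ^ (n / 2 : ℂ)) ^ 2 *
      ((π / (a - Complex.I)) ^ (n / 2 : ℂ) *
        (π / (a * (a - 2 * Complex.I) / (a - Complex.I))) ^ (n / 2 : ℂ))‖ =
      (‖(a - 2 * Complex.I : ℂ)‖ / a) ^ (n / 2 : ℝ) := by
  have hw : 0 < ‖(a - Complex.I : ℂ)‖ :=
    norm_pos_iff.2 fun h => ha.ne' (by simpa using congrArg Complex.re h)
  have hz : 0 < ‖(a - 2 * Complex.I : ℂ)‖ :=
    norm_pos_iff.2 fun h => ha.ne' (by simpa using congrArg Complex.re h)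
  have hexp : (n / 2 : ℂ) = ((n / 2 : ℝ) : ℂ) := by push_cast; rfl
  simp only [hexp, norm_mul, norm_pow, Complex.norm_cpow_real, norm_div, Complex.norm_real,
    Real.norm_of_nonneg pi_pos.le, Real.norm_of_nonneg ha.le]
  rw [sq, ← Real.mul_rpow (by positivity) (by positivity),
    ← Real.mul_rpow (by positivity) (by positivity),
    ← Real.mul_rpow (by positivity) (by positivity)]
  congr 1
  field_simp

lemma re_div_sub_two_mul_I (c a : ℝ) :
    ((c : ℂ) / (a - 2 * Complex.I)).re = c * (a / (a ^ 2 + 4)) := by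
  rw [Complex.div_re]
  simp [Complex.normSq_apply]
  ring

/-- The bilinear multiplier with symbol `exp (-i ‖ξ - η‖ ^ 2)` applied to a pair of Gaussians whose
Fourier transforms have width `a ^ (-1 / 2)`, measured in `L^r`. -/
lemma eLpNorm_bilinear_gaussian {a : ℝ} (ha : 0 < a) (r : ℝ≥0∞)
    {f : V → ℂ} (hf : f = fun x => Complex.exp (-(π ^ 2 / (a - 2 * Complex.I)) * ‖x‖ ^ 2)) :
    eLpNorm (fun x : V => ∫ ξ : V, ∫ η : V,
        𝓕 f ξ * 𝓕 f η * Complex.exp (-Complex.I * ((‖ξ - η‖ : ℝ) ^ 2)) *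
          Complex.exp (2 * (π : ℂ) * Complex.I * (⟪x, ξ + η⟫ : ℝ))) r volume =
      ENNReal.ofReal ((‖(a - 2 * Complex.I : ℂ)‖ / a) ^ (Module.finrank ℝ V / 2 : ℝ)) *
        eLpNorm (fun x : V => rexp (-(2 * π ^ 2 * (a / (a ^ 2 + 4))) * ‖x‖ ^ 2)) r volume := by
  set z : ℂ := a - 2 * Complex.I with hz
  have hz0 : z ≠ 0 := fun h => ha.ne' (by simpa [hz] using congrArg Complex.re h)
  have hpi : (π : ℂ) ≠ 0 := by exact_mod_cast pi_ne_zero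
  have hbre : 0 < ((π : ℂ) ^ 2 / z).re := by
    rw [← Complex.ofReal_pow, hz, re_div_sub_two_mul_I]
    positivity
  have hfourier (ξ : V) : 𝓕 f ξ = (z / π) ^ (Module.finrank ℝ V / 2 : ℂ) *
      Complex.exp (-z * ‖ξ‖ ^ 2) := by
    rw [hf, fourier_gaussian_innerProductSpace hbre]
    congr 2 <;> field_simp
  have hout : (fun x : V => ∫ ξ : V, ∫ η : V,
        𝓕 f ξ * 𝓕 f η * Complex.exp (-Complex.I * ((‖ξ - η‖ : ℝ) ^ 2)) *
          Complex.exp (2 * (π : ℂ) * Complex.I * (⟪x, ξ + η⟫ : ℝ))) =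
      (((z / π) ^ (Module.finrank ℝ V / 2 : ℂ)) ^ 2 *
        ((π / (a - Complex.I)) ^ (Module.finrank ℝ V / 2 : ℂ) *
          (π / (a * z / (a - Complex.I))) ^ (Module.finrank ℝ V / 2 : ℂ))) •
        fun x : V => Complex.exp (-(2 * π ^ 2 / z) * ‖x‖ ^ 2) := by
    funext x
    rw [Pi.smul_apply, smul_eq_mul, mul_assoc (((z / π) ^ (Module.finrank ℝ V / 2 : ℂ)) ^ 2),
      ← integral_gaussian_mul_symbol ha x, ← integral_const_mul]
    congr 1
    funext ξ
    rw [← integral_const_mul]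
    congr 1
    funext η
    rw [hfourier, hfourier, hz]
    ring
  rw [hout, eLpNorm_const_smul, ← ofReal_norm, norm_gaussian_constants ha,
    eLpNorm_cexp_neg_mul_sq_norm, hz,
    show (2 * π ^ 2 : ℂ) = ((2 * π ^ 2 : ℝ) : ℂ) by push_cast; rfl, re_div_sub_two_mul_I]

end Symbol

theorem no_bilinear_bound_in_local_L2_range (n : ℕ) (hn : 0 < n)
    (p q r r' : ℝ≥0∞) (hp : 2 ≤ p) (hq : 2 ≤ q) (hr' : 2 ≤ r')
    (hpqr : 1 / p + 1 / q = 1 / r) (hrr' : 1 / r + 1 / r' = 1) :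
    ¬ ∃ M : ℝ, 0 ≤ M ∧ ∀ f g : SchwartzMap (EuclideanSpace ℝ (Fin n)) ℂ,
      eLpNorm (fun x : EuclideanSpace ℝ (Fin n) =>
          ∫ ξ : EuclideanSpace ℝ (Fin n), ∫ η : EuclideanSpace ℝ (Fin n),
            𝓕 (⇑f) ξ * 𝓕 (⇑g) η * Complex.exp (-Complex.I * ((‖ξ - η‖ : ℝ) ^ 2)) *
              Complex.exp (2 * (π : ℂ) * Complex.I * (⟪x, ξ + η⟫ : ℝ))) r volume ≤
        ENNReal.ofReal M * eLpNorm (⇑f) p volume * eLpNorm (⇑g) q volume := by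
  rintro ⟨M, -, hM⟩
  have hr0 : r ≠ 0 := by
    rintro rfl
    simp at hrr'
  have hp0 : p ≠ 0 := fun h => by simp [h] at hp
  have hq0 : q ≠ 0 := fun h => by simp [h] at hq
  have hexponents : (1 / r).toReal = (1 / p).toReal + (1 / q).toReal := by
    rw [← hpqr, ENNReal.toReal_add (by simpa using hp0) (by simpa using hq0)]
  let V := EuclideanSpace ℝ (Fin n)
  set K : ℝ≥0∞ → ℝ≥0∞ := fun u => eLpNorm (fun x : V => rexp (-π ^ 2 * ‖x‖ ^ 2)) u volume
  set L : ℝ≥0∞ := eLpNorm (fun x : V => rexp (-(2 * π ^ 2) * ‖x‖ ^ 2)) r volume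
  have hKtop (u : ℝ≥0∞) : K u ≠ ∞ := eLpNorm_rexp_neg_mul_sq_norm_ne_top (by positivity) u
  have hL0 : L ≠ 0 := eLpNorm_rexp_neg_mul_sq_norm_ne_zero _ hr0
  have hbound (N : ℕ) (hN : 0 < N) : N * L ≤ ENNReal.ofReal M * K p * K q := by
    set a : ℝ := 2 / (N : ℝ) ^ 2 with ha_def
    have hN' : (1 : ℝ) ≤ N := by exact_mod_cast hN
    have ha : 0 < a := by positivity
    have hs : 0 < a / (a ^ 2 + 4) := by positivity
    have hre : ((π : ℂ) ^ 2 / (a - 2 * Complex.I)).re = π ^ 2 * (a / (a ^ 2 + 4)) := by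
      rw [← Complex.ofReal_pow, re_div_sub_two_mul_I]
    have hbre : 0 < ((π : ℂ) ^ 2 / (a - 2 * Complex.I)).re := by
      rw [hre]
      positivity
    have h := hM (gaussianSchwartz V _ hbre) (gaussianSchwartz V _ hbre)
    rw [eLpNorm_bilinear_gaussian ha r (coe_gaussianSchwartz hbre), coe_gaussianSchwartz,
      eLpNorm_cexp_neg_mul_sq_norm, eLpNorm_cexp_neg_mul_sq_norm, hre,
      eLpNorm_rexp_neg_mul_sq_norm_scale _ hs, eLpNorm_rexp_neg_mul_sq_norm_scale _ hs,
      eLpNorm_rexp_neg_mul_sq_norm_scale _ hs, hexponents] at h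
    set J : ℝ≥0∞ := ENNReal.ofReal |((√(a / (a ^ 2 + 4))) ^ Module.finrank ℝ V)⁻¹| with hJ
    have hJ0 : J ≠ 0 := by
      rw [hJ, Ne, ENNReal.ofReal_eq_zero, not_le]
      positivity
    have hJtop : J ≠ ∞ := ENNReal.ofReal_ne_top
    rw [ENNReal.rpow_add _ _ hJ0 hJtop] at h
    have hJp : J ^ (1 / p).toReal * J ^ (1 / q).toReal ≠ 0 := by
      simp [ENNReal.rpow_eq_zero_iff, hJ0, hJtop]
    have hJq : J ^ (1 / p).toReal * J ^ (1 / q).toReal ≠ ∞ :=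
      ENNReal.mul_ne_top (ENNReal.rpow_ne_top_of_nonneg ENNReal.toReal_nonneg hJtop)
        (ENNReal.rpow_ne_top_of_nonneg ENNReal.toReal_nonneg hJtop)
    have hgrowth : (N : ℝ) ≤ (‖(a - 2 * Complex.I : ℂ)‖ / a) ^ (Module.finrank ℝ V / 2 : ℝ) := by
      have him : 2 ≤ ‖(a - 2 * Complex.I : ℂ)‖ := by
        simpa using Complex.abs_im_le_norm (a - 2 * Complex.I : ℂ)
      have hbase : (N : ℝ) ^ 2 ≤ ‖(a - 2 * Complex.I : ℂ)‖ / a := by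
        rw [le_div_iff₀ ha, ha_def, mul_div_cancel₀ _ (by positivity)]
        exact him
      calc (N : ℝ) ≤ (N : ℝ) ^ n := le_self_pow₀ hN' hn.ne'
        _ = ((N : ℝ) ^ 2) ^ (Module.finrank ℝ V / 2 : ℝ) := by
          rw [finrank_euclideanSpace_fin, ← Real.rpow_natCast_mul (by positivity),
            ← Real.rpow_natCast]
          congr 1
          push_cast
          ring
        _ ≤ _ := by gcongr
    have hcancel : (J ^ (1 / p).toReal * J ^ (1 / q).toReal) * (N * L) ≤
        (J ^ (1 / p).toReal * J ^ (1 / q).toReal) * (ENNReal.ofReal M * K p * K q) := by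
      calc _ = ENNReal.ofReal N * (J ^ (1 / p).toReal * J ^ (1 / q).toReal * L) := by
            rw [ENNReal.ofReal_natCast]
            ring
        _ ≤ _ := mul_le_mul_left (ENNReal.ofReal_le_ofReal hgrowth) _
        _ ≤ _ := h
        _ = _ := by ring
    exact (ENNReal.mul_le_mul_iff_right hJp hJq).1 hcancel
  obtain ⟨N, hN⟩ := ENNReal.exists_nat_mul_gt hL0
    (ENNReal.mul_ne_top (ENNReal.mul_ne_top ENNReal.ofReal_ne_top (hKtop p)) (hKtop q))
  have hNpos : 0 < N := Nat.pos_of_ne_zero fun h => by simp [h] at hN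
  exact (hbound N hNpos).not_gt hN
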